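/- arXiv:2512.08566 — 2 statements merged into one kernel-verified Lean document; each statement's English description precedes it below -/
import Mathlib

section
/- For any small category C, the category RelPsh(C) of relational presheaves over C is complete and cocomplete (it has all small limits and all small colimits). -/
open CategoryTheory

/-- A relational presheaf over a small category `C`. -/
structure RelPsh (C : Type) [SmallCategory C] : Type 1 where
  obj : C → Type
  rel : ∀ {c d : C}, (d ⟶ c) → obj c → obj d → Prop
  refl : ∀ {c : C} (x : obj c), rel (𝟙 c) x x
  trans : ∀ {c d e : C} {f : d ⟶ c} {g : e ⟶ d} {x : obj c} {y : obj d} {z : obj e},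
    rel f x y → rel g y z → rel (g ≫ f) x z

/-- A morphism of relational presheaves. -/
@[ext]
structure RelPshHom {C : Type} [SmallCategory C] (P Q : RelPsh C) where
  app : ∀ c, P.obj c → Q.obj c
  rel : ∀ {c d : C} (f : d ⟶ c) (x : P.obj c) (y : P.obj d),
    P.rel f x y → Q.rel f (app c x) (app d y)

instance {C : Type} [SmallCategory C] : Category (RelPsh C) where
  Hom := RelPshHom
  id P := { app := fun _ x => x, rel := fun _ _ _ h => h }
  comp α β := { app := fun c x => β.app c (α.app c x),
                rel := fun f x y h => β.rel f _ _ (α.rel f x y h) }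

@[ext]
theorem RelPsh.hom_ext {C : Type} [SmallCategory C] {P Q : RelPsh C} {α β : P ⟶ Q}
    (h : ∀ c (x : P.obj c), α.app c x = β.app c x) : α = β :=
  RelPshHom.ext (funext fun c => funext fun x => h c x)

namespace RelPsh

open CategoryTheory.Limits

variable {C J : Type} [SmallCategory C] [SmallCategory J]

theorem app_congr {P Q : RelPsh C} {α β : P ⟶ Q} (h : α = β) (c : C) (x : P.obj c) :
    α.app c x = β.app c x := by rw [h]

/-- The limit of a diagram of relational presheaves: compatible families, related componentwise. -/
def limitObj (F : J ⥤ RelPsh C) : RelPsh C where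
  obj c := { x : ∀ j, (F.obj j).obj c // ∀ ⦃i j⦄ (u : i ⟶ j), (F.map u).app c (x i) = x j }
  rel f x y := ∀ j, (F.obj j).rel f (x.1 j) (y.1 j)
  refl x j := (F.obj j).refl (x.1 j)
  trans h k j := (F.obj j).trans (h j) (k j)

/-- The limit cone of a diagram of relational presheaves. -/
def limitCone (F : J ⥤ RelPsh C) : Cone F where
  pt := limitObj F
  π :=
    { app j := { app := fun _ x => x.1 j, rel := fun _ _ _ h => h j }
      naturality _ _ u := hom_ext fun _ x => (x.2 u).symm }

/-- The cone `limitCone F` is a limit. -/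
def limitConeIsLimit (F : J ⥤ RelPsh C) : IsLimit (limitCone F) where
  lift s :=
    { app := fun c x => ⟨fun j => (s.π.app j).app c x, fun _ _ u => app_congr (s.w u) c x⟩
      rel := fun f x y h j => (s.π.app j).rel f x y h }
  fac _ _ := rfl
  uniq _ _ h := hom_ext fun c x => Subtype.ext (funext fun j => app_congr (h j) c x)

/-- The identifications that define the underlying sets of a colimit. -/
def ColimitRel (F : J ⥤ RelPsh C) (c : C) (x y : Σ j, (F.obj j).obj c) : Prop :=
  ∃ u : x.1 ⟶ y.1, y.2 = (F.map u).app c x.2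

/-- The underlying sets of a colimit of relational presheaves. -/
def ColimitCarrier (F : J ⥤ RelPsh C) (c : C) : Type := Quot (ColimitRel F c)

/-- The smallest relations on the colimit sets that contain the images of the given relations and
are closed under identities and composition. -/
inductive GeneratedRel (F : J ⥤ RelPsh C) :
    ∀ {c d : C}, (d ⟶ c) → ColimitCarrier F c → ColimitCarrier F d → Prop
  | of {c d : C} (f : d ⟶ c) (j : J) (x : (F.obj j).obj c) (y : (F.obj j).obj d)
      (h : (F.obj j).rel f x y) : GeneratedRel F f (Quot.mk _ ⟨j, x⟩) (Quot.mk _ ⟨j, y⟩)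
  | refl {c : C} (x : ColimitCarrier F c) : GeneratedRel F (𝟙 c) x x
  | trans {c d e : C} {f : d ⟶ c} {g : e ⟶ d} {x : ColimitCarrier F c} {y : ColimitCarrier F d}
      {z : ColimitCarrier F e} (h : GeneratedRel F f x y) (k : GeneratedRel F g y z) :
      GeneratedRel F (g ≫ f) x z

/-- The colimit of a diagram of relational presheaves. -/
def colimitObj (F : J ⥤ RelPsh C) : RelPsh C where
  obj := ColimitCarrier F
  rel := GeneratedRel F
  refl := .refl
  trans := .trans

/-- The colimit cocone of a diagram of relational presheaves. -/
def colimitCocone (F : J ⥤ RelPsh C) : Cocone F where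
  pt := colimitObj F
  ι :=
    { app j := { app := fun _ x => Quot.mk _ ⟨j, x⟩, rel := fun f x y h => .of f j x y h }
      naturality _ _ u := hom_ext fun _ _ => (Quot.sound ⟨u, rfl⟩).symm }

/-- The function on underlying sets induced by a cocone. -/
def descApp {F : J ⥤ RelPsh C} (s : Cocone F) (c : C) : ColimitCarrier F c → s.pt.obj c :=
  Quot.lift (fun x => (s.ι.app x.1).app c x.2) <| by
    rintro ⟨i, x⟩ ⟨j, y⟩ ⟨u, hy⟩
    dsimp only at u hy ⊢
    subst hy
    exact (app_congr (s.w u) c x).symm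

theorem descApp_rel {F : J ⥤ RelPsh C} (s : Cocone F) {c d : C} {f : d ⟶ c}
    {x : ColimitCarrier F c} {y : ColimitCarrier F d} (h : GeneratedRel F f x y) :
    s.pt.rel f (descApp s c x) (descApp s d y) := by
  induction h with
  | of f j x y h => exact (s.ι.app j).rel f x y h
  | refl x => exact s.pt.refl _
  | trans _ _ h k => exact s.pt.trans h k

/-- The cocone `colimitCocone F` is a colimit. -/
def colimitCoconeIsColimit (F : J ⥤ RelPsh C) : IsColimit (colimitCocone F) where
  desc s := { app := descApp s, rel := fun _ _ _ h => descApp_rel s h }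
  fac _ _ := rfl
  uniq s m h := hom_ext fun c x => by
    obtain ⟨⟨j, x⟩, rfl⟩ := Quot.exists_rep x
    exact app_congr (h j) c x

end RelPsh

open CategoryTheory.Limits in
/-- For any small category `C`, the category of relational presheaves over `C`
is complete and cocomplete. -/
theorem RelPsh.hasLimits_and_hasColimits (C : Type) [SmallCategory C] :
    HasLimits (RelPsh C) ∧ HasColimits (RelPsh C) := by
  exact ⟨⟨fun _ _ => ⟨fun F => ⟨_, RelPsh.limitConeIsLimit F⟩⟩⟩,
    ⟨fun _ _ => ⟨fun F => ⟨_, RelPsh.colimitCoconeIsColimit F⟩⟩⟩⟩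
end

section
/- Let α, β : P ⇉ Q be a pair of parallel morphisms of relational presheaves over a small category C. For each object c, let ∼ be the equivalence relation on Q(c) generated by α_c(x) ∼ β_c(x) for x ∈ P(c). Define the relational family R₀ by R₀(c) = Q(c)/∼ and [x] →_f [y] if and only if there exist x' ∼ x and y' ∼ y with x' →_f y' in Q. Then the closure under composition of R₀ (the relational presheaf obtained from R₀ by the left adjoint to the inclusion RelPsh(C) ↪ RelFam(C)), together with the evident quotient map from Q, is the coequalizer of α and β in RelPsh(C). -/
open CategoryTheory

/-- A relational family over `C`: like a relational presheaf but with no conditions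
on the relations. -/
structure RelFam (C : Type) [SmallCategory C] : Type 1 where
  obj : C → Type
  rel : ∀ {c d : C}, (d ⟶ c) → obj c → obj d → Prop

/-- A morphism of relational families. -/
@[ext]
structure RelFamHom {C : Type} [SmallCategory C] (P Q : RelFam C) where
  app : ∀ c, P.obj c → Q.obj c
  rel : ∀ {c d : C} (f : d ⟶ c) (x : P.obj c) (y : P.obj d),
    P.rel f x y → Q.rel f (app c x) (app d y)

instance {C : Type} [SmallCategory C] : Category (RelFam C) where
  Hom := RelFamHom
  id P := { app := fun _ x => x, rel := fun _ _ _ h => h }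
  comp α β := { app := fun c x => β.app c (α.app c x),
                rel := fun f x y h => β.rel f _ _ (α.rel f x y h) }

@[ext]
theorem RelFam.hom_ext {C : Type} [SmallCategory C] {P Q : RelFam C} {α β : P ⟶ Q}
    (h : ∀ c (x : P.obj c), α.app c x = β.app c x) : α = β :=
  RelFamHom.ext (funext fun c => funext fun x => h c x)

/-- The closure under composition of the relations of a relational family: add the
diagonal at each identity and iteratively add composites. -/
inductive CompClosure {C : Type} [SmallCategory C] (M : RelFam C) :
    ∀ {c d : C}, (d ⟶ c) → M.obj c → M.obj d → Prop
  | of {c d : C} {f : d ⟶ c} {x y} : M.rel f x y → CompClosure M f x y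
  | refl {c : C} (x : M.obj c) : CompClosure M (𝟙 c) x x
  | trans {c d e : C} {f : d ⟶ c} {g : e ⟶ d} {x y z} :
      CompClosure M f x y → CompClosure M g y z → CompClosure M (g ≫ f) x z

/-- The closure under composition of a relational family, as a relational presheaf:
the smallest relational presheaf containing `M`. -/
def RelFam.comp {C : Type} [SmallCategory C] (M : RelFam C) : RelPsh C where
  obj := M.obj
  rel := CompClosure M
  refl := .refl
  trans := .trans

/-- The full inclusion of relational presheaves into relational families. -/
def inclFam (C : Type) [SmallCategory C] : RelPsh C ⥤ RelFam C where
  obj P := ⟨P.obj, P.rel⟩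
  map α := ⟨α.app, α.rel⟩

/-- Closure under composition, as a functor `RelFam C ⥤ RelPsh C`. -/
def compFunctor (C : Type) [SmallCategory C] : RelFam C ⥤ RelPsh C where
  obj M := M.comp
  map {M N} α :=
    { app := α.app
      rel := fun {c d} f x y h => by
        induction h with
        | of h => exact .of (α.rel _ _ _ h)
        | refl x => exact .refl _
        | trans h1 h2 ih1 ih2 => exact .trans ih1 ih2 }

variable {C : Type} [SmallCategory C]

/-- The generating relation for the coequalizer quotient: `x ∼ y` when `x = α_c(p)` and
`y = β_c(p)` for some `p ∈ P(c)`.  `Quot` then quotients by the equivalence relation it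
generates. -/
def coeqGen {P Q : RelPsh C} (α β : P ⟶ Q) (c : C) (x y : Q.obj c) : Prop :=
  ∃ p : P.obj c, α.app c p = x ∧ β.app c p = y

/-- The relational family `R₀` underlying the coequalizer: `R₀(c) = Q(c)/∼` and
`[x] →_f [y]` iff there are `x' ∼ x`, `y' ∼ y` with `x' →_f y'` in `Q`. -/
def coeqFam {P Q : RelPsh C} (α β : P ⟶ Q) : RelFam C where
  obj c := Quot (coeqGen α β c)
  rel {c d} f X Y := ∃ (x' : Q.obj c) (y' : Q.obj d),
    Quot.mk (coeqGen α β c) x' = X ∧ Quot.mk (coeqGen α β d) y' = Y ∧ Q.rel f x' y'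

/-- The evident quotient map from `Q` to the closure under composition of `R₀`. -/
def coeqπ {P Q : RelPsh C} (α β : P ⟶ Q) : Q ⟶ (coeqFam α β).comp where
  app c x := Quot.mk (coeqGen α β c) x
  rel f x y h := .of ⟨x, y, rfl, rfl, h⟩

theorem coeq_condition {P Q : RelPsh C} (α β : P ⟶ Q) :
    α ≫ coeqπ α β = β ≫ coeqπ α β := by
  apply RelPsh.hom_ext
  intro c p
  exact Quot.sound ⟨p, rfl, rfl⟩

/-- A morphism from a relational family to a relational presheaf extends along the closure under
composition. -/
def RelFam.compDesc {M : RelFam C} {T : RelPsh C} (φ : M ⟶ (inclFam C).obj T) : M.comp ⟶ T where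
  app := φ.app
  rel _ _ _ h := by
    induction h with
    | of h => exact φ.rel _ _ _ h
    | refl x => exact T.refl _
    | trans _ _ ih₁ ih₂ => exact T.trans ih₁ ih₂

/-- A morphism out of `Q` that coequalizes `α` and `β` descends to the family `R₀`. -/
def coeqFamDesc {P Q T : RelPsh C} (α β : P ⟶ Q) (φ : Q ⟶ T) (h : α ≫ φ = β ≫ φ) :
    coeqFam α β ⟶ (inclFam C).obj T where
  app c := Quot.lift (φ.app c) (by
    rintro _ _ ⟨p, rfl, rfl⟩
    exact congrFun (congrFun (congrArg RelPshHom.app h) c) p)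
  rel _ _ _ := by
    rintro ⟨x, y, rfl, rfl, hxy⟩
    exact φ.rel _ x y hxy

open CategoryTheory.Limits in
/-- the closure under composition of `R₀`, with the evident quotient map
from `Q`, is the coequalizer of `α` and `β` in `RelPsh C`. -/
theorem coeq_isColimit {P Q : RelPsh C} (α β : P ⟶ Q) :
    Nonempty (IsColimit (Cofork.ofπ (coeqπ α β) (coeq_condition α β))) := by
  refine ⟨Cofork.IsColimit.mk _
    (fun s => RelFam.compDesc (coeqFamDesc α β s.π s.condition)) (fun _ => rfl) ?_⟩
  intro s m hm
  apply RelPsh.hom_ext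
  rintro c ⟨x⟩
  exact congrFun (congrFun (congrArg RelPshHom.app hm) c) x
end
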